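/- In the minimum-counterexample setup, for every acyclic edge coloring c of G−xy using Δ+1 colors, no color of F''_x(c) appears on an edge incident with y' other than the edge yy'; that is, F''_x(c) ∩ S_{yy'}(c) = ∅, where S_{yy'}(c) denotes the set of colors assigned by c to the edges of G−xy incident with y' other than yy'. -/

import Mathlib

open SimpleGraph

namespace AEC

variable {V : Type*}

/-- The set of colors appearing (under partial coloring `c`) on colored edges incident
with the vertex `u` (i.e. `F_u`). -/
def colorsAt (G : SimpleGraph V) (c : Sym2 V → Option ℕ) (u : V) : Set ℕ :=
  {γ | ∃ z, G.Adj u z ∧ c s(u, z) = some γ}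

/-- `S_ab`: the set of colors appearing on the colored edges incident with `b`
other than the edge `ab`. -/
def Sset (G : SimpleGraph V) (c : Sym2 V → Option ℕ) (a b : V) : Set ℕ :=
  {γ | ∃ z, G.Adj b z ∧ z ≠ a ∧ c s(b, z) = some γ}

/-- A partial edge coloring (colors are `ℕ`, `none` = uncolored): it may only color
edges of `G`, and colored edges sharing an endpoint receive distinct colors. -/
def ProperPartialColoring (G : SimpleGraph V) (c : Sym2 V → Option ℕ) : Prop :=
  (∀ e, (c e).isSome → e ∈ G.edgeSet) ∧
  ∀ ⦃u v w : V⦄, G.Adj u v → G.Adj u w → v ≠ w → (c s(u, v)).isSome →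
    c s(u, v) ≠ c s(u, w)

/-- A valid (acyclic) partial coloring: proper, and no cycle of `G` is bichromatic,
i.e. no cycle has all of its edges colored using only two colors. -/
def AcyclicPartialColoring (G : SimpleGraph V) (c : Sym2 V → Option ℕ) : Prop :=
  ProperPartialColoring G c ∧
  ∀ (α β : ℕ) (v : V) (W : G.Walk v v), W.IsCycle →
    ¬ ∀ e ∈ W.edges, c e = some α ∨ c e = some β

/-- An acyclic edge coloring of `G` using (at most) `k` colors: a valid partial coloring
that colors every edge of `G` with a color `< k`. -/
def IsAcyclicEdgeColoring (G : SimpleGraph V) (k : ℕ) (c : Sym2 V → Option ℕ) : Prop :=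
  AcyclicPartialColoring G c ∧ ∀ e ∈ G.edgeSet, ∃ a, a < k ∧ c e = some a

/-- `G` is 2-degenerate: every nonempty (induced) subgraph has a vertex of degree at most 2. -/
def TwoDegenerate [DecidableEq V] (G : SimpleGraph V) [DecidableRel G.Adj] : Prop :=
  ∀ s : Finset V, s.Nonempty → ∃ v ∈ s, (s.filter fun u => G.Adj v u).card ≤ 2

/-- A maximal `(α,β)`-bichromatic path from `a` to `b`: a path all of whose edges are
colored `α` or `β`, which cannot be extended at either end. -/
def IsMaximalBichromaticPath (G : SimpleGraph V) (c : Sym2 V → Option ℕ)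
    (α β : ℕ) {a b : V} (W : G.Walk a b) : Prop :=
  W.IsPath ∧ (∀ e ∈ W.edges, c e = some α ∨ c e = some β) ∧
  (∀ w, G.Adj a w → (c s(a, w) = some α ∨ c s(a, w) = some β) → w ∈ W.support) ∧
  (∀ w, G.Adj b w → (c s(b, w) = some α ∨ c s(b, w) = some β) → w ∈ W.support)

/-- An `(α,β,a,b)`-maximal bichromatic path: a maximal `(α,β)`-bichromatic path from
`a` to `b` whose edge incident on `a` is colored `α`. -/
def IsMaxBichromaticPathFrom (G : SimpleGraph V) (c : Sym2 V → Option ℕ)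
    (α β : ℕ) {a b : V} (W : G.Walk a b) : Prop :=
  IsMaximalBichromaticPath G c α β W ∧ ∃ e, W.edges.head? = some e ∧ c e = some α

/-- An `(α,β,ab)`-critical path: a maximal `(α,β)`-bichromatic path from `a` to `b` whose
edges incident on `a` and on `b` are both colored `α`. -/
def IsCriticalPath (G : SimpleGraph V) (c : Sym2 V → Option ℕ)
    (α β : ℕ) {a b : V} (W : G.Walk a b) : Prop :=
  IsMaxBichromaticPathFrom G c α β W ∧ ∃ e, W.edges.getLast? = some e ∧ c e = some α

/-- `F''_x(c)`: colors of edges from `x` to its neighbors (other than `y`) of degree ≥ 3. -/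
def Fpp [Fintype V] (G : SimpleGraph V) [DecidableRel G.Adj]
    (c : Sym2 V → Option ℕ) (x y : V) : Set ℕ :=
  {γ | ∃ z, G.Adj x z ∧ z ≠ y ∧ 3 ≤ G.degree z ∧ c s(x, z) = some γ}

/-- `F'_x(c)`: colors of edges from `x` to its neighbors (other than `y`) of degree 2. -/
def Fp [Fintype V] (G : SimpleGraph V) [DecidableRel G.Adj]
    (c : Sym2 V → Option ℕ) (x y : V) : Set ℕ :=
  {γ | ∃ z, G.Adj x z ∧ z ≠ y ∧ G.degree z = 2 ∧ c s(x, z) = some γ}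

/-- `F_x(c) = F'_x(c) ∪ F''_x(c)`. -/
def Fx [Fintype V] (G : SimpleGraph V) [DecidableRel G.Adj]
    (c : Sym2 V → Option ℕ) (x y : V) : Set ℕ :=
  Fp G c x y ∪ Fpp G c x y

/-- A vertex incident with an edge of a cycle is incident with a second edge of that cycle. -/
theorem exists_other_edge_of_isCycle {G : SimpleGraph V} {v : V} {W : G.Walk v v}
    (hW : W.IsCycle) {a b : V} (h : s(a, b) ∈ W.edges) :
    ∃ w, w ≠ b ∧ s(a, w) ∈ W.edges := by
  have h2 := hW.ncard_neighborSet_toSubgraph_eq_two (W.fst_mem_support_of_mem_edges h)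
  obtain ⟨w, hw, hwb⟩ := Set.exists_ne_of_one_lt_ncard (h2 ▸ Nat.one_lt_two) b
  refine ⟨w, hwb, ?_⟩
  rwa [← Walk.mem_edges_toSubgraph, Subgraph.mem_edgeSet]

/-- Extending a coloring of `G - xy` over the edge `xy`, where `y` has degree two: the edge `yy'`
is recolored `a`, and `xy` receives a color `θ` which closes no `(a, θ)`-bichromatic cycle. -/
theorem exists_isAcyclicEdgeColoring_of_extension [DecidableEq V] {G : SimpleGraph V} {k : ℕ}
    {x y y' : V} {c : Sym2 V → Option ℕ}
    (hc : IsAcyclicEdgeColoring (G.deleteEdges {s(x, y)}) k c)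
    (hxy : G.Adj x y) (hyy' : G.Adj y y') (hy'x : y' ≠ x)
    (hy : ∀ w, G.Adj y w → w = x ∨ w = y')
    {a θ : ℕ} (hak : a < k) (hθk : θ < k) (haθ : θ ≠ a)
    (ha : a ∉ Sset (G.deleteEdges {s(x, y)}) c y y')
    (hθ : ∀ z, G.Adj x z → z ≠ y → c s(x, z) ≠ some θ)
    (hcrit : ∀ z, G.Adj x z → z ≠ y → c s(x, z) = some a →
      ∀ w, G.Adj z w → w ≠ x → c s(z, w) ≠ some θ) :
    ∃ c' : Sym2 V → Option ℕ, IsAcyclicEdgeColoring G k c' := by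
  obtain ⟨⟨⟨hsupp, hprop⟩, hacyc⟩, htot⟩ := hc
  have hadj : ∀ {u v}, (G.deleteEdges {s(x, y)}).Adj u v ↔ G.Adj u v ∧ s(u, v) ≠ s(x, y) := by
    intro u v; simp [deleteEdges_adj]
  have ha' : ∀ z, G.Adj y' z → z ≠ y → c s(y', z) ≠ some a := by
    intro z hz hzy h
    refine ha ⟨z, hadj.2 ⟨hz, ?_⟩, hzy, h⟩
    have := hyy'.ne
    grind [Sym2.eq_iff]
  have hne : s(x, y) ≠ s(y, y') := by
    have := hxy.ne
    grind [Sym2.eq_iff]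
  set c' : Sym2 V → Option ℕ := Function.update (Function.update c s(y, y') (some a))
    s(x, y) (some θ) with hc'
  have c'xy : c' s(x, y) = some θ := by simp [hc']
  have c'yy' : c' s(y, y') = some a := by simp [hc', hne.symm]
  have c'of : ∀ e, e ≠ s(x, y) → e ≠ s(y, y') → c' e = c e := by
    intro e h1 h2; simp [hc', h1, h2]
  have c'off : ∀ u v, u ≠ y → v ≠ y → c' s(u, v) = c s(u, v) := by
    intro u v hu hv
    apply c'of <;> grind [Sym2.eq_iff]
  have htot' : ∀ e ∈ G.edgeSet, ∃ b, b < k ∧ c' e = some b := by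
    intro e he
    by_cases h1 : e = s(x, y)
    · exact ⟨θ, hθk, h1 ▸ c'xy⟩
    by_cases h2 : e = s(y, y')
    · exact ⟨a, hak, h2 ▸ c'yy'⟩
    rw [c'of e h1 h2]
    exact htot e (by simp [he, h1])
  have hprop' : ∀ ⦃u v w : V⦄, G.Adj u v → G.Adj u w → v ≠ w → c' s(u, v) ≠ c' s(u, w) := by
    intro u v w hv hw hvw
    have hyx : c' s(y, x) = some θ := by rw [Sym2.eq_swap]; exact c'xy
    have hy'y : c' s(y', y) = some a := by rw [Sym2.eq_swap]; exact c'yy'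
    have aux : ∀ v w, G.Adj u v → G.Adj u w → u ≠ y → w = y → v ≠ y →
        c' s(u, v) ≠ c' s(u, w) := by
      rintro v w hv hw hu rfl hvy
      rw [c'off u v hu hvy]
      rcases hy u hw.symm with rfl | rfl
      · rw [c'xy]; exact hθ v hv hvy
      · rw [hy'y]; exact ha' v hv hvy
    by_cases hu : u = y
    · subst hu
      have haθ' := haθ.symm
      rcases hy v hv with rfl | rfl <;> rcases hy w hw with rfl | rfl <;> simp_all
    by_cases hwy : w = y
    · exact aux v w hv hw hu hwy (by rintro rfl; exact hvw hwy.symm)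
    by_cases hvy : v = y
    · exact (aux w v hw hv hu hvy hwy).symm
    have h1 : (G.deleteEdges {s(x, y)}).Adj u v := hadj.2 ⟨hv, by grind [Sym2.eq_iff]⟩
    have h2 : (G.deleteEdges {s(x, y)}).Adj u w := hadj.2 ⟨hw, by grind [Sym2.eq_iff]⟩
    rw [c'off u v hu hvy, c'off u w hu hwy]
    obtain ⟨b, -, hb⟩ := htot s(u, v) h1
    exact hprop h1 h2 hvw (by simp [hb])
  refine ⟨c', ⟨⟨?_, fun u v w hv hw hvw _ => hprop' hv hw hvw⟩, ?_⟩, htot'⟩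
  · intro e he
    by_cases h1 : e = s(x, y)
    · exact h1 ▸ hxy
    by_cases h2 : e = s(y, y')
    · exact h2 ▸ hyy'
    rw [c'of e h1 h2] at he
    have := hsupp e he
    simp only [edgeSet_deleteEdges] at this
    exact this.1
  · intro α β v W hW hbi
    by_cases hmem : s(x, y) ∈ W.edges
    · have hcol : ∀ e ∈ W.edges, c' e = some θ ∨ c' e = some a := by
        obtain ⟨w, hwx, hw⟩ := exists_other_edge_of_isCycle hW (Sym2.eq_swap (a := x) ▸ hmem)
        have hwy' : w = y' := (hy w (W.adj_of_mem_edges hw)).resolve_left hwx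
        subst hwy'
        have h1 := hbi _ hmem
        have h2 := hbi _ hw
        rw [c'xy] at h1
        rw [c'yy'] at h2
        intro e he
        have h3 := hbi e he
        grind
      obtain ⟨z, hzy, hz⟩ := exists_other_edge_of_isCycle hW hmem
      have hxz := W.adj_of_mem_edges hz
      have hcz : c s(x, z) = some a := by
        have h := hcol _ hz
        rw [c'off x z hxy.ne hzy] at h
        exact h.resolve_left (hθ z hxz hzy)
      obtain ⟨w, hwx, hw⟩ := exists_other_edge_of_isCycle hW (Sym2.eq_swap (a := x) ▸ hz)
      have hzw := W.adj_of_mem_edges hw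
      have hwy : w ≠ y := by
        rintro rfl
        rcases hy z hzw.symm with rfl | rfl
        · exact hxz.ne rfl
        · exact ha' x hxz.symm hxy.ne (Sym2.eq_swap (a := x) ▸ hcz)
      rcases hcol _ hw with h | h
      · rw [c'off z w hzy hwy] at h
        exact hcrit z hxz hzy hcz w hzw hwx h
      · refine hprop' hzw hxz.symm hwx ?_
        rw [h, c'off z x hzy hxy.ne, Sym2.eq_swap, hcz]
    · have hmem' : s(y, y') ∉ W.edges := by
        intro h
        obtain ⟨w, hw, hwe⟩ := exists_other_edge_of_isCycle hW h
        obtain rfl := (hy w (W.adj_of_mem_edges hwe)).resolve_right hw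
        exact hmem (Sym2.eq_swap (a := y) ▸ hwe)
      have hin : ∀ e ∈ W.edges, e ∈ (G.deleteEdges {s(x, y)}).edgeSet := by
        intro e he
        have := W.edges_subset_edgeSet he
        simp only [edgeSet_deleteEdges]
        exact ⟨this, by rintro rfl; exact hmem he⟩
      refine hacyc α β v (W.transfer _ hin) (hW.transfer hin) ?_
      intro e he
      rw [Walk.edges_transfer] at he
      rw [← c'of e (by rintro rfl; exact hmem he) (by rintro rfl; exact hmem' he)]
      exact hbi e he

/-- If `G` has no acyclic edge coloring with `Δ + 1` colors, then each color that can be given to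
`yy'` in a coloring of `G - xy` lies in `F''_x`. -/
theorem mem_Fpp_of_notMem_Sset [Fintype V] [DecidableEq V] {G : SimpleGraph V}
    [DecidableRel G.Adj]
    (hmin : ¬ ∃ c : Sym2 V → Option ℕ, IsAcyclicEdgeColoring G (G.maxDegree + 1) c)
    {x y y' : V} (hxy : G.Adj x y) (hy2 : G.degree y = 2) (hyy' : G.Adj y y') (hy'x : y' ≠ x)
    {c : Sym2 V → Option ℕ}
    (hc : IsAcyclicEdgeColoring (G.deleteEdges {s(x, y)}) (G.maxDegree + 1) c)
    {a : ℕ} (hak : a < G.maxDegree + 1) (ha : a ∉ Sset (G.deleteEdges {s(x, y)}) c y y') :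
    a ∈ Fpp G c x y := by
  by_contra hF
  apply hmin
  have hy : ∀ w, G.Adj y w → w = x ∨ w = y' := by
    intro w hw
    have hsub : ({x, y'} : Finset V) ⊆ G.neighborFinset y := by
      intro u hu
      simp only [Finset.mem_insert, Finset.mem_singleton] at hu
      rcases hu with rfl | rfl
      · simpa using hxy.symm
      · simpa using hyy'
    have heq := Finset.eq_of_subset_of_card_le hsub
      (by rw [card_neighborFinset_eq_degree, hy2, Finset.card_pair hy'x.symm])
    have : w ∈ ({x, y'} : Finset V) := by rw [heq]; simpa using hw
    simpa using this
  let F : Finset ℕ := ((G.neighborFinset x).erase y).image fun z => (c s(x, z)).getD 0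
  have hFcard : F.card + 1 ≤ G.maxDegree := by
    have h1 : F.card ≤ ((G.neighborFinset x).erase y).card := Finset.card_image_le
    have h2 := Finset.card_erase_add_one (show y ∈ G.neighborFinset x by simpa using hxy)
    have h3 := G.degree_le_maxDegree x
    rw [card_neighborFinset_eq_degree] at h2
    omega
  have hFmem : ∀ z γ, G.Adj x z → z ≠ y → c s(x, z) = some γ → γ ∈ F := by
    intro z γ hz hzy h
    exact Finset.mem_image.2 ⟨z, by simp [hz, hzy], by simp [h]⟩
  obtain ⟨E, hE, hEprop⟩ : ∃ E : Finset ℕ, E.card ≤ 1 ∧ ∀ θ, θ ∉ F → θ ∉ E → θ ≠ a ∧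
      ∀ z, G.Adj x z → z ≠ y → c s(x, z) = some a →
        ∀ w, G.Adj z w → w ≠ x → c s(z, w) ≠ some θ := by
    by_cases hex : ∃ z, G.Adj x z ∧ z ≠ y ∧ c s(x, z) = some a
    · obtain ⟨z, hxz, hzy, hcz⟩ := hex
      have hdeg : G.degree z ≤ 2 := by
        by_contra h
        exact hF ⟨z, hxz, hzy, by omega, hcz⟩
      refine ⟨((G.neighborFinset z).erase x).image fun w => (c s(z, w)).getD 0, ?_, ?_⟩
      · have h1 := Finset.card_image_le (s := (G.neighborFinset z).erase x)
          (f := fun w => (c s(z, w)).getD 0)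
        have h2 := Finset.card_erase_add_one
          (show x ∈ G.neighborFinset z by simpa using hxz.symm)
        rw [card_neighborFinset_eq_degree] at h2
        omega
      · intro θ hθF hθE
        refine ⟨by rintro rfl; exact hθF (hFmem z _ hxz hzy hcz), ?_⟩
        intro z₁ hxz₁ hz₁y hcz₁ w hw hwx hcw
        have hz : z₁ = z := by
          by_contra hne
          refine hc.1.1.2 (u := x) (v := z₁) (w := z) ?_ ?_ hne (by simp [hcz₁])
            (by rw [hcz, hcz₁])
          · simp only [deleteEdges_adj, Set.mem_singleton_iff]
            exact ⟨hxz₁, by grind [Sym2.eq_iff]⟩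
          · simp only [deleteEdges_adj, Set.mem_singleton_iff]
            exact ⟨hxz, by grind [Sym2.eq_iff]⟩
        subst hz
        exact hθE (Finset.mem_image.2 ⟨w, by simp [hw, hwx], by simp [hcw]⟩)
    · refine ⟨{a}, by simp, fun θ _ hθ => ⟨by simpa using hθ, ?_⟩⟩
      intro z hxz hzy hcz
      exact absurd ⟨z, hxz, hzy, hcz⟩ hex
  obtain ⟨θ, hθr, hθ⟩ := Finset.exists_mem_notMem_of_card_lt_card
    (s := F ∪ E) (t := Finset.range (G.maxDegree + 1)) (by
      have := Finset.card_union_le F E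
      rw [Finset.card_range]
      omega)
  rw [Finset.notMem_union] at hθ
  obtain ⟨hθa, hcrit⟩ := hEprop θ hθ.1 hθ.2
  exact exists_isAcyclicEdgeColoring_of_extension hc hxy hyy' hy'x hy hak
    (Finset.mem_range.1 hθr) hθa ha (fun z hz hzy h => hθ.1 (hFmem z θ hz hzy h)) hcrit

/-- Lemma 4: in the minimum-counterexample setup, no color of `F''_x(c)`
appears on an edge of `G − xy` incident with `y'` other than `yy'`:
`F''_x(c) ∩ S_{yy'}(c) = ∅`. -/
theorem Fpp_inter_Syy'_empty
    {V : Type*} [Fintype V] [DecidableEq V] (G : SimpleGraph V) [DecidableRel G.Adj]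
    (h2deg : TwoDegenerate G)
    (hmin : ¬ ∃ c : Sym2 V → Option ℕ, IsAcyclicEdgeColoring G (G.maxDegree + 1) c)
    (hdel : ∀ e ∈ G.edgeSet, ∃ c : Sym2 V → Option ℕ,
      IsAcyclicEdgeColoring (G.deleteEdges {e}) (G.maxDegree + 1) c)
    (x : V)
    (hxdeg2 : ∃ z, G.Adj x z ∧ G.degree z = 2)
    (hxdeg3 : ((G.neighborFinset x).filter fun z => 3 ≤ G.degree z).card ≤ 2)
    (y y' : V) (hxy : G.Adj x y) (hy2 : G.degree y = 2)
    (hyy' : G.Adj y y') (hy'x : y' ≠ x)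
    (c : Sym2 V → Option ℕ)
    (hc : IsAcyclicEdgeColoring (G.deleteEdges {s(x, y)}) (G.maxDegree + 1) c) :
    Fpp G c x y ∩ Sset (G.deleteEdges {s(x, y)}) c y y' = ∅ := by
  rw [Set.eq_empty_iff_forall_notMem]
  rintro γ ⟨⟨z, hxz, hzy, hdz, hcz⟩, w, hw, hwy, hcw⟩
  let S : Finset ℕ := ((G.neighborFinset y').erase y).image fun z => (c s(y', z)).getD 0
  let F : Finset ℕ :=
    ((G.neighborFinset x).filter fun z => 3 ≤ G.degree z).image fun z => (c s(x, z)).getD 0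
  have hS : S.card + 1 ≤ G.maxDegree := by
    have h1 : S.card ≤ ((G.neighborFinset y').erase y).card := Finset.card_image_le
    have h2 := Finset.card_erase_add_one (show y ∈ G.neighborFinset y' by simpa using hyy'.symm)
    have h3 := G.degree_le_maxDegree y'
    rw [card_neighborFinset_eq_degree] at h2
    omega
  have hF : F.card ≤ 2 := Finset.card_image_le.trans hxdeg3
  have hγF : γ ∈ F := Finset.mem_image.2 ⟨z, by simp [hxz, hdz], by simp [hcz]⟩
  have hγS : γ ∈ S := Finset.mem_image.2 ⟨w, by simp [hw.1, hwy], by simp [hcw]⟩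
  have hsub : Finset.range (G.maxDegree + 1) \ S ⊆ F.erase γ := by
    intro a ha
    rw [Finset.mem_sdiff, Finset.mem_range] at ha
    refine Finset.mem_erase.2 ⟨by rintro rfl; exact ha.2 hγS, ?_⟩
    obtain ⟨u, hxu, -, hdu, hcu⟩ : a ∈ Fpp G c x y := by
      refine mem_Fpp_of_notMem_Sset hmin hxy hy2 hyy' hy'x hc ha.1 ?_
      rintro ⟨u, hu, huy, hcu⟩
      exact ha.2 (Finset.mem_image.2 ⟨u, by simp [hu.1, huy], by simp [hcu]⟩)
    exact Finset.mem_image.2 ⟨u, by simp [hxu, hdu], by simp [hcu]⟩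
  have h1 := Finset.card_le_card hsub
  have h2 := Finset.le_card_sdiff S (Finset.range (G.maxDegree + 1))
  have h3 := Finset.card_erase_add_one hγF
  rw [Finset.card_range] at h2
  omega

end AEC
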